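/- Assume conditions (1.2) with r ≡ 1, let u, v be a principal fundamental system of solutions of z'' = q z, and suppose there exists a₀ ∈ (0,∞) with inf_{x∈ℝ} ∫_{x-a₀}^{x+a₀} q(t) dt > 0. Then for every p ∈ (1,∞) the Green operator G is bounded on L_p(ℝ), and G : L_p(ℝ) → L_p(ℝ) is compact if and only if Molchanov's condition holds: for every a ∈ (0,∞), ∫_{x-a}^{x+a} q(t) dt → ∞ as |x| → ∞. -/

import Mathlib

open MeasureTheory Filter Topology
open scoped ENNReal RealInnerProductSpace

noncomputable section

/-- Conditions (1.2): `r, q` measurable, `r > 0`, `q ≥ 0`, with `1/r` and `q`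
locally Lebesgue integrable on `ℝ`. -/
def Cond12 (r q : ℝ → ℝ) : Prop :=
  Measurable r ∧ Measurable q ∧ (∀ x, 0 < r x) ∧ (∀ x, 0 ≤ q x) ∧
    LocallyIntegrable (fun t => 1 / r t) volume ∧ LocallyIntegrable q volume

/-- Condition (1.3): for every `x`,
`(∫_{x-d}^x dt/r(t)) · (∫_{x-d}^x q(t) dt) → ∞` as `|d| → ∞`. -/
def Cond13 (r q : ℝ → ℝ) : Prop :=
  ∀ x : ℝ, Tendsto (fun d : ℝ => (∫ t in x - d..x, 1 / r t) * (∫ t in x - d..x, q t))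
    (cocompact ℝ) atTop

/-- Condition (2.1): `∫_{-∞}^x q > 0` and `∫_x^∞ q > 0` for every `x`. -/
def Cond21 (q : ℝ → ℝ) : Prop :=
  ∀ x : ℝ, 0 < ∫⁻ t in Set.Iic x, ENNReal.ofReal (q t) ∧
    0 < ∫⁻ t in Set.Ici x, ENNReal.ofReal (q t)

/-- A principal fundamental system of solutions `u, v` (with a.e. derivatives
`u', v'`) of the equation `(r z')' = q z`:  `u, v, r u', r v'` are locally
absolutely continuous (expressed through the integral identities below),
`(r u')' = q u` and `(r v')' = q v` a.e., `u > 0`, `v > 0`, `v' ≥ 0`, `u' ≤ 0`,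
`r (v' u - u' v) ≡ 1`, `v/u → 0` at `-∞`, `u/v → 0` at `+∞`,
`∫_{-∞}^0 dt/(r u²) < ∞` and `∫_0^∞ dt/(r v²) < ∞`. -/
structure PFSS (r q u v u' v' : ℝ → ℝ) : Prop where
  u_pos : ∀ x, 0 < u x
  v_pos : ∀ x, 0 < v x
  u'_nonpos : ∀ x, u' x ≤ 0
  v'_nonneg : ∀ x, 0 ≤ v' x
  u'_intble : ∀ a b : ℝ, IntervalIntegrable u' volume a b
  v'_intble : ∀ a b : ℝ, IntervalIntegrable v' volume a b
  u_deriv : ∀ a b : ℝ, u b - u a = ∫ t in a..b, u' t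
  v_deriv : ∀ a b : ℝ, v b - v a = ∫ t in a..b, v' t
  ru'_deriv : ∀ a b : ℝ, r b * u' b - r a * u' a = ∫ t in a..b, q t * u t
  rv'_deriv : ∀ a b : ℝ, r b * v' b - r a * v' a = ∫ t in a..b, q t * v t
  wronskian : ∀ x, r x * (v' x * u x - u' x * v x) = 1
  ratio_bot : Tendsto (fun x => v x / u x) atBot (𝓝 0)
  ratio_top : Tendsto (fun x => u x / v x) atTop (𝓝 0)
  int_u : ∫⁻ t in Set.Iic (0:ℝ), ENNReal.ofReal (1 / (r t * u t ^ 2)) < ⊤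
  int_v : ∫⁻ t in Set.Ici (0:ℝ), ENNReal.ofReal (1 / (r t * v t ^ 2)) < ⊤

/-- The Green kernel `G(x,t) = u(x) v(t)` for `x ≥ t`, `u(t) v(x)` for `x ≤ t`. -/
def greenKernel (u v : ℝ → ℝ) (x t : ℝ) : ℝ :=
  if t ≤ x then u x * v t else u t * v x

/-- The space `L_p(ℝ)` (with respect to Lebesgue measure). -/
abbrev LpR (p : ℝ≥0∞) : Type := Lp ℝ p (volume : Measure ℝ)

/-- `G` is (a bounded realization on `L_p` of) the Green operator
`(G f)(x) = ∫_ℝ G(x,t) f(t) dt`. -/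
def IsGreenOp (u v : ℝ → ℝ) (p : ℝ≥0∞) [Fact (1 ≤ p)]
    (G : LpR p →L[ℝ] LpR p) : Prop :=
  ∀ f : LpR p,
    (G f : ℝ → ℝ) =ᵐ[volume] fun x => ∫ t, greenKernel u v x t * (f : ℝ → ℝ) t

/-- `d₁` solves `(∫_{x-d}^x dt/r)(∫_{x-d}^x q dt) = 1`, `d₁ > 0`. -/
def IsD1 (r q d₁ : ℝ → ℝ) : Prop :=
  ∀ x : ℝ, 0 < d₁ x ∧
    (∫ t in x - d₁ x..x, 1 / r t) * (∫ t in x - d₁ x..x, q t) = 1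

/-- `d₂` solves `(∫_x^{x+d} dt/r)(∫_x^{x+d} q dt) = 1`, `d₂ > 0`. -/
def IsD2 (r q d₂ : ℝ → ℝ) : Prop :=
  ∀ x : ℝ, 0 < d₂ x ∧
    (∫ t in x..x + d₂ x, 1 / r t) * (∫ t in x..x + d₂ x, q t) = 1

/-- `φ(x) = ∫_{x-d₁(x)}^x dt/r(t)`. -/
def phiF (r d₁ : ℝ → ℝ) (x : ℝ) : ℝ := ∫ t in x - d₁ x..x, 1 / r t

/-- `ψ(x) = ∫_x^{x+d₂(x)} dt/r(t)`. -/
def psiF (r d₂ : ℝ → ℝ) (x : ℝ) : ℝ := ∫ t in x..x + d₂ x, 1 / r t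

/-- `h(x) = φ(x)ψ(x)/(φ(x)+ψ(x))`. -/
def hF (r d₁ d₂ : ℝ → ℝ) (x : ℝ) : ℝ :=
  phiF r d₁ x * psiF r d₂ x / (phiF r d₁ x + psiF r d₂ x)

/-- `d` solves `∫_{x-d(x)}^{x+d(x)} dt/(r(t)h(t)) = 1`, `d > 0`. -/
def IsD (r h d : ℝ → ℝ) : Prop :=
  ∀ x : ℝ, 0 < d x ∧ (∫ t in x - d x..x + d x, 1 / (r t * h t)) = 1

/-- `s` solves `∫_{x-s(x)}^{x+s(x)} dt/(r(t)ρ(t)) = 1`, `s > 0`. -/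
def IsS (r ρ s : ℝ → ℝ) : Prop :=
  ∀ x : ℝ, 0 < s x ∧ (∫ t in x - s x..x + s x, 1 / (r t * ρ t)) = 1


/-- A positive nondecreasing solution `v` (with derivative `v'`) of `z'' = q z` with `q ≥ 0`. -/
structure IncreasingSolution (q v v' : ℝ → ℝ) : Prop where
  q_nonneg : ∀ x, 0 ≤ q x
  q_intble : LocallyIntegrable q volume
  pos : ∀ x, 0 < v x
  nonneg : ∀ x, 0 ≤ v' x
  intble : ∀ a b : ℝ, IntervalIntegrable v' volume a b
  sub_eq : ∀ a b : ℝ, v b - v a = ∫ t in a..b, v' t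
  sub_eq' : ∀ a b : ℝ, v' b - v' a = ∫ t in a..b, q t * v t

namespace IncreasingSolution

variable {q v v' : ℝ → ℝ}

theorem continuous (h : IncreasingSolution q v v') : Continuous v := by
  have h1 : v = fun x => v 0 + ∫ t in (0 : ℝ)..x, v' t := by
    funext x; linarith [h.sub_eq 0 x]
  rw [h1]
  exact continuous_const.add (intervalIntegral.continuous_primitive h.intble 0)

theorem intervalIntegrable (h : IncreasingSolution q v v') (a b : ℝ) :
    IntervalIntegrable q volume a b :=
  intervalIntegrable_iff.2 ((h.q_intble.integrableOn_isCompact isCompact_uIcc).mono_set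
    Set.uIoc_subset_uIcc)

theorem intervalIntegrable_mul (h : IncreasingSolution q v v') (a b : ℝ) :
    IntervalIntegrable (fun t => q t * v t) volume a b :=
  (h.intervalIntegrable a b).mul_continuousOn h.continuous.continuousOn

theorem continuous' (h : IncreasingSolution q v v') : Continuous v' := by
  have h1 : v' = fun x => v' 0 + ∫ t in (0 : ℝ)..x, q t * v t := by
    funext x; linarith [h.sub_eq' 0 x]
  rw [h1]
  exact continuous_const.add (intervalIntegral.continuous_primitive h.intervalIntegrable_mul 0)

theorem hasDerivAt (h : IncreasingSolution q v v') (x : ℝ) : HasDerivAt v (v' x) x := by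
  have h1 : v = fun x => v 0 + ∫ t in (0 : ℝ)..x, v' t := by
    funext x; linarith [h.sub_eq 0 x]
  rw [h1]
  exact (intervalIntegral.integral_hasDerivAt_right (h.intble 0 x)
    h.continuous'.stronglyMeasurable.stronglyMeasurableAtFilter
    h.continuous'.continuousAt).const_add (v 0)

theorem monotone (h : IncreasingSolution q v v') : Monotone v := fun a b hab => by
  have h1 := intervalIntegral.integral_nonneg (μ := volume) hab fun t _ => h.nonneg t
  linarith [h.sub_eq a b]

theorem monotone' (h : IncreasingSolution q v v') : Monotone v' := fun a b hab => by
  have h1 := intervalIntegral.integral_nonneg (μ := volume) hab fun t _ =>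
    mul_nonneg (h.q_nonneg t) (h.pos t).le
  linarith [h.sub_eq' a b]

theorem sub_le (h : IncreasingSolution q v v') {a b : ℝ} (hab : a ≤ b) :
    v b - v a ≤ (b - a) * v' b := by
  rw [h.sub_eq a b]
  have h1 := intervalIntegral.integral_mono_on (μ := volume) hab (h.intble a b)
    intervalIntegrable_const fun t ht => h.monotone' ht.2
  simpa using h1

theorem le_sub (h : IncreasingSolution q v v') {a b : ℝ} (hab : a ≤ b) :
    (b - a) * v' a ≤ v b - v a := by
  rw [h.sub_eq a b]
  have h1 := intervalIntegral.integral_mono_on (μ := volume) hab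
    intervalIntegrable_const (h.intble a b) fun t ht => h.monotone' ht.1
  simpa using h1

theorem sub_le' (h : IncreasingSolution q v v') {a b : ℝ} (hab : a ≤ b) :
    v' b - v' a ≤ (∫ t in a..b, q t) * v b := by
  rw [h.sub_eq' a b, ← intervalIntegral.integral_mul_const]
  exact intervalIntegral.integral_mono_on hab (h.intervalIntegrable_mul a b)
    ((h.intervalIntegrable a b).mul_const _) fun t ht =>
      mul_le_mul_of_nonneg_left (h.monotone ht.2) (h.q_nonneg t)

theorem le_sub' (h : IncreasingSolution q v v') {a b : ℝ} (hab : a ≤ b) :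
    (∫ t in a..b, q t) * v a ≤ v' b - v' a := by
  rw [h.sub_eq' a b, ← intervalIntegral.integral_mul_const]
  exact intervalIntegral.integral_mono_on hab
    ((h.intervalIntegrable a b).mul_const _) (h.intervalIntegrable_mul a b) fun t ht =>
      mul_le_mul_of_nonneg_left (h.monotone ht.1) (h.q_nonneg t)

/-- If `q` has mass at least `m` on `[x - a, x]`, then `v / v'` is at most `1 / m + a` at `x`. -/
theorem le_mul_deriv (h : IncreasingSolution q v v') {x a m : ℝ} (ha : 0 ≤ a) (hm : 0 < m)
    (hq : m ≤ ∫ t in x - a..x, q t) : v x ≤ (1 / m + a) * v' x := by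
  have hax : x - a ≤ x := by linarith
  have h1 := h.sub_le hax
  have h2 := h.le_sub' hax
  have h3 : m * v (x - a) ≤ v' x := by
    have := mul_le_mul_of_nonneg_right hq (h.pos (x - a)).le
    linarith [h.nonneg (x - a)]
  have h4 : v (x - a) ≤ 1 / m * v' x := by
    rw [one_div, ← div_eq_inv_mul, le_div_iff₀ hm]; linarith
  linarith

/-- If `q` has mass at most `C` on `[x - a, x]`, then `v' / v` is at most `1 / a + C` at `x`. -/
theorem deriv_le_mul (h : IncreasingSolution q v v') {x a C : ℝ} (ha : 0 < a)
    (hq : ∫ t in x - a..x, q t ≤ C) : v' x ≤ (1 / a + C) * v x := by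
  have hax : x - a ≤ x := by linarith
  have h1 := h.le_sub hax
  have h2 := h.sub_le' hax
  have h3 : v' x - v' (x - a) ≤ C * v x := h2.trans (mul_le_mul_of_nonneg_right hq (h.pos x).le)
  have h4 : v' (x - a) ≤ 1 / a * v x := by
    rw [one_div, ← div_eq_inv_mul, le_div_iff₀ ha]; linarith [h.pos (x - a)]
  linarith

theorem le_exp_mul (h : IncreasingSolution q v v') {κ : ℝ} (hκ : ∀ x, κ * v x ≤ v' x)
    {t x : ℝ} (htx : t ≤ x) : v t ≤ Real.exp (-(κ * (x - t))) * v x := by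
  have hd : ∀ y, HasDerivAt (fun y => v y * Real.exp (-(κ * y)))
      (v' y * Real.exp (-(κ * y)) + v y * (Real.exp (-(κ * y)) * (-(κ * 1)))) y := fun y =>
    (h.hasDerivAt y).mul (((hasDerivAt_id y).const_mul κ).neg.exp)
  have hmono : Monotone fun y => v y * Real.exp (-(κ * y)) :=
    monotone_of_deriv_nonneg (fun y => (hd y).differentiableAt) fun y => by
      rw [(hd y).deriv]
      nlinarith [hκ y, Real.exp_pos (-(κ * y))]
  have h1 := mul_le_mul_of_nonneg_right (hmono htx) (Real.exp_pos (κ * t)).le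
  simp only [mul_assoc, ← Real.exp_add] at h1
  have e1 : -(κ * t) + κ * t = 0 := by ring
  have e2 : -(κ * x) + κ * t = -(κ * (x - t)) := by ring
  rw [e1, e2, Real.exp_zero, mul_one] at h1
  linarith

end IncreasingSolution

theorem PFSS.increasingSolution {q u v u' v' : ℝ → ℝ} (h12 : Cond12 (fun _ => 1) q)
    (h : PFSS (fun _ => 1) q u v u' v') : IncreasingSolution q v v' where
  q_nonneg := h12.2.2.2.1
  q_intble := h12.2.2.2.2.2
  pos := h.v_pos
  nonneg := h.v'_nonneg
  intble := h.v'_intble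
  sub_eq := h.v_deriv
  sub_eq' a b := by simpa using h.rv'_deriv a b

theorem PFSS.increasingSolution_neg {q u v u' v' : ℝ → ℝ} (h12 : Cond12 (fun _ => 1) q)
    (h : PFSS (fun _ => 1) q u v u' v') :
    IncreasingSolution (fun x => q (-x)) (fun x => u (-x)) (fun x => -u' (-x)) where
  q_nonneg x := h12.2.2.2.1 (-x)
  q_intble := by
    have h1 := h12.2.2.2.2.2
    intro x
    obtain ⟨s, hs, hi⟩ := h1 (-x)
    refine ⟨Neg.neg ⁻¹' s, continuous_neg.continuousAt.preimage_mem_nhds hs, ?_⟩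
    exact ((Measure.measurePreserving_neg (volume : Measure ℝ)).integrableOn_comp_preimage
      (Homeomorph.neg ℝ).measurableEmbedding).2 hi
  pos x := h.u_pos (-x)
  nonneg x := by linarith [h.u'_nonpos (-x)]
  intble a b := by
    have := (h.u'_intble (-a) (-b)).neg
    rw [IntervalIntegrable.iff_comp_neg] at this
    simpa using this
  sub_eq a b := by
    have h1 := h.u_deriv (-a) (-b)
    rw [intervalIntegral.integral_neg, intervalIntegral.integral_comp_neg (fun t => u' t), h1,
      intervalIntegral.integral_symm (-b) (-a)]
  sub_eq' a b := by
    have h1 := h.ru'_deriv (-a) (-b)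
    rw [intervalIntegral.integral_comp_neg (fun t => q t * u t),
      intervalIntegral.integral_symm (-a) (-b), ← h1]
    ring

theorem greenKernel_eq_min {u v : ℝ → ℝ} (hu : Antitone u) (hv : Monotone v)
    (hu0 : ∀ x, 0 < u x) (hv0 : ∀ x, 0 < v x) (x t : ℝ) :
    greenKernel u v x t = min (u x * v t) (u t * v x) := by
  unfold greenKernel
  split_ifs with h
  · exact (min_eq_left (mul_le_mul (hu h) (hv h) (hv0 t).le (hu0 t).le)).symm
  · have h' := (not_le.1 h).le
    exact (min_eq_right (mul_le_mul (hu h') (hv h') (hv0 x).le (hu0 x).le)).symm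

theorem measurable_greenKernel {u v : ℝ → ℝ} (hu : Continuous u) (hv : Continuous v) :
    Measurable fun z : ℝ × ℝ => greenKernel u v z.1 z.2 := by
  unfold greenKernel
  exact Measurable.ite (measurableSet_le measurable_snd measurable_fst)
    (by fun_prop) (by fun_prop)

namespace PFSS

variable {q u v u' v' : ℝ → ℝ}

theorem monotone_v (h12 : Cond12 (fun _ => 1) q) (h : PFSS (fun _ => 1) q u v u' v') :
    Monotone v := (h.increasingSolution h12).monotone

theorem antitone_u (h12 : Cond12 (fun _ => 1) q) (h : PFSS (fun _ => 1) q u v u' v') :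
    Antitone u := fun a b hab => by
  simpa using (h.increasingSolution_neg h12).monotone (neg_le_neg hab)

theorem continuous_v (h12 : Cond12 (fun _ => 1) q) (h : PFSS (fun _ => 1) q u v u' v') :
    Continuous v := (h.increasingSolution h12).continuous

theorem continuous_u (h12 : Cond12 (fun _ => 1) q) (h : PFSS (fun _ => 1) q u v u' v') :
    Continuous u := by
  simpa [Function.comp_def] using (h.increasingSolution_neg h12).continuous.comp continuous_neg

theorem eq_min (h12 : Cond12 (fun _ => 1) q) (h : PFSS (fun _ => 1) q u v u' v') (x t : ℝ) :
    greenKernel u v x t = min (u x * v t) (u t * v x) :=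
  greenKernel_eq_min (h.antitone_u h12) (h.monotone_v h12) h.u_pos h.v_pos x t

theorem kernel_pos (h12 : Cond12 (fun _ => 1) q) (h : PFSS (fun _ => 1) q u v u' v') (x t : ℝ) :
    0 < greenKernel u v x t := by
  rw [h.eq_min h12]
  exact lt_min (mul_pos (h.u_pos x) (h.v_pos t)) (mul_pos (h.u_pos t) (h.v_pos x))

/-- If `q` has mass at least `m` on `[x - a, x + a]`, then the Green kernel at `(x + a, x + a)`
is at most `1 / m + 2 a`. -/
theorem diag_le (h12 : Cond12 (fun _ => 1) q) (h : PFSS (fun _ => 1) q u v u' v')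
    {x a m : ℝ} (ha : 0 < a) (hm : 0 < m) (hq : m ≤ ∫ t in x - a..x + a, q t) :
    u (x + a) * v (x + a) ≤ 1 / m + 2 * a := by
  have h1 := (h.increasingSolution h12).le_mul_deriv (x := x + a) (a := 2 * a) (by linarith) hm
    (by rwa [show x + a - 2 * a = x - a by ring])
  have hw := h.wronskian (x + a)
  have h2 : v' (x + a) * u (x + a) ≤ 1 := by
    nlinarith [mul_nonneg (neg_nonneg.2 (h.u'_nonpos (x + a))) (h.v_pos (x + a)).le]
  have h3 : 0 < 1 / m + 2 * a := by positivity
  nlinarith [mul_le_mul_of_nonneg_left h1 (h.u_pos (x + a)).le]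

theorem le_deriv_v (h12 : Cond12 (fun _ => 1) q) (h : PFSS (fun _ => 1) q u v u' v')
    {a m : ℝ} (ha : 0 < a) (hm : 0 < m) (hq : ∀ x, m ≤ ∫ t in x - a..x + a, q t) (x : ℝ) :
    (1 / m + 2 * a)⁻¹ * v x ≤ v' x := by
  have h1 := (h.increasingSolution h12).le_mul_deriv (x := x) (a := 2 * a) (by linarith) hm
    (by convert hq (x - a) using 2 <;> ring)
  rwa [inv_mul_le_iff₀ (by positivity)]

theorem le_deriv_u (h12 : Cond12 (fun _ => 1) q) (h : PFSS (fun _ => 1) q u v u' v')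
    {a m : ℝ} (ha : 0 < a) (hm : 0 < m) (hq : ∀ x, m ≤ ∫ t in x - a..x + a, q t) (x : ℝ) :
    (1 / m + 2 * a)⁻¹ * u x ≤ -u' x := by
  have h1 := (h.increasingSolution_neg h12).le_mul_deriv (x := -x) (a := 2 * a) (by linarith) hm
    (by
      rw [intervalIntegral.integral_comp_neg (fun t => q t)]
      convert hq (x + a) using 2 <;> ring)
  rw [neg_neg] at h1
  rwa [inv_mul_le_iff₀ (by positivity)]

theorem kernel_le (h12 : Cond12 (fun _ => 1) q) (h : PFSS (fun _ => 1) q u v u' v')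
    {κ : ℝ} (hv : ∀ x, κ * v x ≤ v' x) (hu : ∀ x, κ * u x ≤ -u' x) (x t : ℝ) :
    greenKernel u v x t ≤ u x * v x * Real.exp (-(κ * |x - t|)) := by
  unfold greenKernel
  split_ifs with htx
  · have h1 := (h.increasingSolution h12).le_exp_mul hv htx
    rw [abs_of_nonneg (sub_nonneg.2 htx)]
    nlinarith [mul_le_mul_of_nonneg_left h1 (h.u_pos x).le]
  · have hxt := (not_le.1 htx).le
    have h1 := (h.increasingSolution_neg h12).le_exp_mul (κ := κ)
      (fun x => by simpa using hu (-x)) (neg_le_neg hxt)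
    simp only [neg_neg] at h1
    rw [abs_of_nonpos (sub_nonpos.2 hxt)]
    rw [show -x - -t = -(x - t) by ring] at h1
    nlinarith [mul_le_mul_of_nonneg_left h1 (h.v_pos x).le]

/-- If `q` has mass at most `C` near `x`, then the Green kernel is bounded below near `(x, x)`. -/
theorem le_kernel (h12 : Cond12 (fun _ => 1) q) (h : PFSS (fun _ => 1) q u v u' v')
    {x a C M : ℝ} (ha : 0 < a) (hq : ∫ t in x - a..x + a, q t ≤ C) (hM : M = 2 / a + C)
    {s t : ℝ} (hs : s ∈ Set.Icc (x - 1 / (4 * M)) (x + 1 / (4 * M)))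
    (ht : t ∈ Set.Icc (x - 1 / (4 * M)) (x + 1 / (4 * M))) :
    1 / (4 * M) ≤ greenKernel u v s t := by
  have hq0 := h12.2.2.2.1
  have hiv := (h.increasingSolution h12).intervalIntegrable
  have hC : 0 ≤ C := (intervalIntegral.integral_nonneg (μ := volume)
    (by linarith : x - a ≤ x + a) fun t _ => hq0 t).trans hq
  have hMa : 2 / a ≤ M := by linarith
  have hM0 : 0 < M := lt_of_lt_of_le (by positivity) hMa
  have hb : 1 / (4 * M) ≤ a / 8 := by
    rw [div_le_iff₀ ha] at hMa
    rw [div_le_iff₀ (by positivity)]; linarith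
  have hmono : ∀ c d, x - a ≤ c → c ≤ d → d ≤ x + a → ∫ t in c..d, q t ≤ C := fun c d h1 h2 h3 =>
    (intervalIntegral.integral_mono_interval h1 h2 h3 (ae_of_all _ hq0) (hiv _ _)).trans hq
  have key : ∀ s t, t ≤ s → s ∈ Set.Icc (x - 1 / (4 * M)) (x + 1 / (4 * M)) →
      t ∈ Set.Icc (x - 1 / (4 * M)) (x + 1 / (4 * M)) → 1 / (4 * M) ≤ u s * v t := by
    intro s t hts hs ht
    have h1 : v' s ≤ M * v s := by
      have := (h.increasingSolution h12).deriv_le_mul (x := s) (a := a / 2) (C := C) (by linarith)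
        (hmono _ _ (by linarith [hs.1]) (by linarith) (by linarith [hs.2]))
      rwa [one_div_div, ← hM] at this
    have h2 : -u' s ≤ M * u s := by
      have := (h.increasingSolution_neg h12).deriv_le_mul (x := -s) (a := a / 2) (C := C)
        (by linarith) (by
          rw [intervalIntegral.integral_comp_neg (fun t => q t)]
          exact hmono _ _ (by linarith [hs.1]) (by linarith) (by linarith [hs.2]))
      simp only [neg_neg] at this
      rwa [one_div_div, ← hM] at this
    have h3 : 1 ≤ 2 * M * (u s * v s) := by
      have hw := h.wronskian s
      nlinarith [mul_le_mul_of_nonneg_right h1 (h.u_pos s).le,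
        mul_le_mul_of_nonneg_right h2 (h.v_pos s).le]
    have h4 : v s ≤ 2 * v t := by
      have h5 := (h.increasingSolution h12).sub_le hts
      have h6 : s - t ≤ 2 * (1 / (4 * M)) := by linarith [hs.2, ht.1]
      have h7 : (s - t) * v' s ≤ 2 * (1 / (4 * M)) * (M * v s) :=
        mul_le_mul h6 h1 (h.v'_nonneg s) (by positivity)
      have h8 : 2 * (1 / (4 * M)) * (M * v s) = v s / 2 := by field_simp; norm_num
      linarith
    rw [div_le_iff₀ (by positivity)]
    have h9 := mul_le_mul_of_nonneg_left h4 (mul_pos (mul_pos two_pos hM0) (h.u_pos s)).le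
    nlinarith
  unfold greenKernel
  split_ifs with hts
  · exact key s t hts hs ht
  · exact key t s (not_le.1 hts).le ht hs

end PFSS

theorem integrable_exp_neg_mul_abs {κ : ℝ} (hκ : 0 < κ) :
    Integrable fun y : ℝ => Real.exp (-(κ * |y|)) := by
  rw [← integrableOn_univ, ← Set.Iic_union_Ioi (a := (0 : ℝ))]
  refine IntegrableOn.union ?_ ?_
  · refine (integrableOn_exp_mul_Iic hκ 0).congr_fun (fun y hy => ?_) measurableSet_Iic
    simp only [abs_of_nonpos (Set.mem_Iic.1 hy)]
    ring_nf
  · refine (integrableOn_exp_mul_Ioi (neg_lt_zero.2 hκ) 0).congr_fun (fun y hy => ?_)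
      measurableSet_Ioi
    simp only [abs_of_pos (Set.mem_Ioi.1 hy)]
    ring_nf

theorem memLp_exp_neg_mul_abs {κ : ℝ} (hκ : 0 < κ) {r : ℝ≥0∞} (hr0 : r ≠ 0) (hr : r ≠ ⊤) :
    MemLp (fun y : ℝ => Real.exp (-(κ * |y|))) r := by
  rw [← integrable_norm_rpow_iff (by fun_prop) hr0 hr]
  have hr' := ENNReal.toReal_pos hr0 hr
  refine (integrable_exp_neg_mul_abs (mul_pos hκ hr')).congr (ae_of_all _ fun y => ?_)
  simp only [Real.norm_eq_abs, Real.abs_exp, ← Real.exp_mul]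
  ring_nf

/-- Schur's test for convolution-type majorants. -/
theorem eLpNorm_le_of_enorm_le_lintegral {ψ : ℝ → ℝ≥0∞} (hψ : Measurable ψ) {p : ℝ≥0∞}
    (hp1 : 1 < p) (hp2 : p ≠ ⊤) {f h : ℝ → ℝ} (hf : AEStronglyMeasurable f volume)
    (c : ℝ≥0∞) (hh : ∀ᵐ x, ‖h x‖ₑ ≤ c * ∫⁻ t, ψ (x - t) * ‖f t‖ₑ) :
    eLpNorm h p ≤ c * (∫⁻ y, ψ y) * eLpNorm f p := by
  have hp0 : p ≠ 0 := (zero_lt_one.trans hp1).ne'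
  set r := p.toReal with hr
  have hr1 : 1 < r := by
    rw [hr, ← ENNReal.toReal_one]; exact (ENNReal.toReal_lt_toReal ENNReal.one_ne_top hp2).2 hp1
  have hr0 : 0 < r := zero_lt_one.trans hr1
  have hrs := Real.HolderConjugate.conjExponent hr1
  set s := r.conjExponent
  have hs0 : 0 < s := hrs.symm.pos
  set A := ∫⁻ y, ψ y with hA
  have hfm : AEMeasurable (fun t => ‖f t‖ₑ) volume := hf.enorm
  have hAx : ∀ x, ∫⁻ t, ψ (x - t) = A := fun x => lintegral_sub_left_eq_self ψ x
  have hAt : ∀ t, ∫⁻ x, ψ (x - t) = A := fun t => lintegral_sub_right_eq_self ψ t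
  have hsr : r * (1 / s) = r - 1 := by
    have := hrs.one_div_add_one_div
    field_simp at this ⊢
    nlinarith
  have hholder : ∀ x, (∫⁻ t, ψ (x - t) * ‖f t‖ₑ) ^ r ≤
      A ^ (r - 1) * ∫⁻ t, ψ (x - t) * ‖f t‖ₑ ^ r := by
    intro x
    have hψx : Measurable fun t => ψ (x - t) := hψ.comp (measurable_const.sub measurable_id)
    have h1 := ENNReal.lintegral_mul_le_Lp_mul_Lq (volume : Measure ℝ) hrs.symm
      (f := fun t => ψ (x - t) ^ (1 / s)) (g := fun t => ψ (x - t) ^ (1 / r) * ‖f t‖ₑ)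
      (hψx.pow_const _).aemeasurable ((hψx.pow_const _).aemeasurable.mul hfm)
    have e1 : ∀ t, ((fun t => ψ (x - t) ^ (1 / s)) * fun t => ψ (x - t) ^ (1 / r) * ‖f t‖ₑ) t =
        ψ (x - t) * ‖f t‖ₑ := fun t => by
      simp only [Pi.mul_apply]
      rw [← mul_assoc, ← ENNReal.rpow_add_of_nonneg _ _ (by positivity) (by positivity),
        add_comm, hrs.one_div_add_one_div]
      simp
    have e2 : ∀ t, (ψ (x - t) ^ (1 / s)) ^ s = ψ (x - t) := fun t => by
      rw [← ENNReal.rpow_mul, one_div_mul_cancel hs0.ne', ENNReal.rpow_one]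
    have e3 : ∀ t, (ψ (x - t) ^ (1 / r) * ‖f t‖ₑ) ^ r = ψ (x - t) * ‖f t‖ₑ ^ r := fun t => by
      rw [ENNReal.mul_rpow_of_nonneg _ _ hr0.le, ← ENNReal.rpow_mul,
        one_div_mul_cancel hr0.ne', ENNReal.rpow_one]
    simp only [e1, e2, e3, hAx] at h1
    calc _ ≤ (A ^ (1 / s) * (∫⁻ t, ψ (x - t) * ‖f t‖ₑ ^ r) ^ (1 / r)) ^ r :=
          ENNReal.rpow_le_rpow h1 hr0.le
      _ = _ := by
          rw [ENNReal.mul_rpow_of_nonneg _ _ hr0.le, ← ENNReal.rpow_mul, ← ENNReal.rpow_mul,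
            one_div_mul_cancel hr0.ne', ENNReal.rpow_one, mul_comm (1 / s), hsr]
  have hswap : ∫⁻ x, ∫⁻ t, ψ (x - t) * ‖f t‖ₑ ^ r = A * ∫⁻ t, ‖f t‖ₑ ^ r := by
    rw [lintegral_lintegral_swap]
    · have : ∀ t, ∫⁻ x, ψ (x - t) * ‖f t‖ₑ ^ r = A * ‖f t‖ₑ ^ r := fun t => by
        have hψt : Measurable fun x => ψ (x - t) := hψ.comp (measurable_id.sub measurable_const)
        rw [lintegral_mul_const _ hψt, hAt]
      simp only [this]
      rw [lintegral_const_mul'' _ (hfm.pow_const r)]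
    · refine AEMeasurable.mul ?_ ?_
      · exact (hψ.comp (measurable_fst.sub measurable_snd)).aemeasurable
      · exact ((hfm.pow_const r).comp_quasiMeasurePreserving
          Measure.quasiMeasurePreserving_snd)
  rw [eLpNorm_eq_lintegral_rpow_enorm_toReal hp0 hp2, eLpNorm_eq_lintegral_rpow_enorm_toReal hp0 hp2,
    ← hr]
  have hArr : A ^ (r - 1) * A = A ^ r := by
    nth_rw 2 [← ENNReal.rpow_one A]
    rw [← ENNReal.rpow_add_of_nonneg _ _ (by linarith) zero_le_one]
    ring_nf
  calc (∫⁻ x, ‖h x‖ₑ ^ r) ^ (1 / r)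
      ≤ (∫⁻ x, c ^ r * A ^ (r - 1) * ∫⁻ t, ψ (x - t) * ‖f t‖ₑ ^ r) ^ (1 / r) := by
        refine ENNReal.rpow_le_rpow (lintegral_mono_ae ?_) (by positivity)
        filter_upwards [hh] with x hx
        calc _ ≤ (c * ∫⁻ t, ψ (x - t) * ‖f t‖ₑ) ^ r := ENNReal.rpow_le_rpow hx hr0.le
          _ = c ^ r * (∫⁻ t, ψ (x - t) * ‖f t‖ₑ) ^ r := ENNReal.mul_rpow_of_nonneg _ _ hr0.le
          _ ≤ _ := by rw [mul_assoc]; gcongr; exact hholder x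
    _ = (c ^ r * A ^ r * ∫⁻ t, ‖f t‖ₑ ^ r) ^ (1 / r) := by
        rw [lintegral_const_mul'', hswap, ← hArr]
        · ring_nf
        · exact AEMeasurable.lintegral_prod_right' (f := fun z : ℝ × ℝ => ψ (z.1 - z.2) * ‖f z.2‖ₑ ^ r)
            (((hψ.comp (measurable_fst.sub measurable_snd)).aemeasurable).mul
            ((hfm.pow_const r).comp_quasiMeasurePreserving Measure.quasiMeasurePreserving_snd))
    _ = _ := by
        rw [ENNReal.mul_rpow_of_nonneg _ _ (by positivity), ← ENNReal.mul_rpow_of_nonneg _ _ hr0.le,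
          ← ENNReal.rpow_mul, mul_one_div_cancel hr0.ne', ENNReal.rpow_one]

theorem lintegral_exp_neg_mul_abs {κ : ℝ} (hκ : 0 < κ) :
    ∫⁻ y : ℝ, ENNReal.ofReal (Real.exp (-(κ * |y|))) =
      ENNReal.ofReal (∫ y : ℝ, Real.exp (-(κ * |y|))) :=
  (ofReal_integral_eq_lintegral_ofReal (integrable_exp_neg_mul_abs hκ)
    (ae_of_all _ fun _ => (Real.exp_pos _).le)).symm

theorem integral_exp_neg_mul_abs_nonneg (κ : ℝ) : 0 ≤ ∫ y : ℝ, Real.exp (-(κ * |y|)) :=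
  integral_nonneg fun _ => (Real.exp_pos _).le

section ExponentialKernel

variable {p : ℝ≥0∞} {κ c : ℝ}

theorem memLp_of_abs_le_exp (hκ : 0 < κ) {r : ℝ≥0∞} (hr0 : r ≠ 0) (hr : r ≠ ⊤) {k : ℝ → ℝ}
    (hk : Measurable k) {x : ℝ} (hkb : ∀ t, |k t| ≤ c * Real.exp (-(κ * |x - t|))) :
    MemLp k r := by
  have h1 := ((memLp_exp_neg_mul_abs hκ hr0 hr).comp_measurePreserving
    (Measure.measurePreserving_sub_left volume x)).const_mul c
  exact h1.mono' hk.aestronglyMeasurable (ae_of_all _ hkb)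

theorem eLpNorm_integral_le (hp1 : 1 < p) (hp2 : p ≠ ⊤) (hκ : 0 < κ) (hc : 0 ≤ c)
    {k : ℝ → ℝ → ℝ} (hkb : ∀ x t, |k x t| ≤ c * Real.exp (-(κ * |x - t|)))
    {f h : ℝ → ℝ} (hf : AEStronglyMeasurable f volume) (hh : h =ᵐ[volume] fun x => ∫ t, k x t * f t) :
    eLpNorm h p ≤ ENNReal.ofReal (c * ∫ y : ℝ, Real.exp (-(κ * |y|))) * eLpNorm f p := by
  rw [ENNReal.ofReal_mul hc, ← lintegral_exp_neg_mul_abs hκ]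
  refine eLpNorm_le_of_enorm_le_lintegral (by fun_prop) hp1 hp2 hf _ ?_
  filter_upwards [hh] with x hx
  rw [hx, ← lintegral_const_mul' _ _ ENNReal.ofReal_ne_top]
  refine (enorm_integral_le_lintegral_enorm _).trans (lintegral_mono fun t => ?_)
  rw [enorm_mul, ← mul_assoc, ← ENNReal.ofReal_mul hc, Real.enorm_eq_ofReal_abs (k x t)]
  gcongr
  exact hkb x t

theorem conjExponent_ne_zero : ENNReal.conjExponent p ≠ 0 := by
  simp [ENNReal.conjExponent]

theorem conjExponent_ne_top (hp1 : 1 < p) : ENNReal.conjExponent p ≠ ⊤ := by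
  simp only [ENNReal.conjExponent, ne_eq, ENNReal.add_eq_top, ENNReal.one_ne_top, false_or,
    ENNReal.inv_eq_top]
  exact (tsub_pos_of_lt hp1).ne'

theorem norm_le_of_ae_eq_integral (hp1 : 1 < p) (hp2 : p ≠ ⊤) (hκ : 0 < κ) (hc : 0 ≤ c)
    {k : ℝ → ℝ → ℝ} (hkb : ∀ x t, |k x t| ≤ c * Real.exp (-(κ * |x - t|)))
    {f h : LpR p} (hh : (h : ℝ → ℝ) =ᵐ[volume] fun x => ∫ t, k x t * (f : ℝ → ℝ) t) :
    ‖h‖ ≤ c * (∫ y : ℝ, Real.exp (-(κ * |y|))) * ‖f‖ := by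
  have h1 := eLpNorm_integral_le hp1 hp2 hκ hc hkb (Lp.aestronglyMeasurable f) hh
  rw [Lp.norm_def, Lp.norm_def]
  have h2 := ENNReal.toReal_mono (ENNReal.mul_ne_top ENNReal.ofReal_ne_top (Lp.eLpNorm_ne_top f)) h1
  rwa [ENNReal.toReal_mul,
    ENNReal.toReal_ofReal (mul_nonneg hc (integral_exp_neg_mul_abs_nonneg κ))] at h2

variable [Fact (1 ≤ p)]

theorem integrable_mul_of_abs_le_exp (hp1 : 1 < p) (hκ : 0 < κ) {k : ℝ → ℝ}
    (hk : Measurable k) {x : ℝ} (hkb : ∀ t, |k t| ≤ c * Real.exp (-(κ * |x - t|))) (f : LpR p) :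
    Integrable fun t => k t * (f : ℝ → ℝ) t :=
  (memLp_of_abs_le_exp hκ conjExponent_ne_zero (conjExponent_ne_top hp1) hk hkb).integrable_mul
    (Lp.memLp f)

/-- Integration against an exponentially decaying function, as a functional on `L_p`. -/
theorem exists_functional (hp1 : 1 < p) (hκ : 0 < κ) {k : ℝ → ℝ}
    (hk : Measurable k) {x : ℝ} (hkb : ∀ t, |k t| ≤ c * Real.exp (-(κ * |x - t|))) :
    ∃ φ : LpR p →L[ℝ] ℝ, ∀ f : LpR p, φ f = ∫ t, k t * (f : ℝ → ℝ) t := by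
  have hm := memLp_of_abs_le_exp hκ conjExponent_ne_zero (conjExponent_ne_top hp1) hk hkb
  have : Fact (1 ≤ ENNReal.conjExponent p) := ⟨by simp [ENNReal.conjExponent]⟩
  refine ⟨(ContinuousLinearMap.mul ℝ ℝ).lpPairing volume (ENNReal.conjExponent p) p
    (hm.toLp k), fun f => ?_⟩
  rw [ContinuousLinearMap.lpPairing_eq_integral]
  refine integral_congr_ae ?_
  filter_upwards [hm.coeFn_toLp] with t ht
  simp [ht]

/-- Boundedness on `L_p` of an integral operator with exponentially decaying kernel. -/
theorem exists_integralOperator (hp1 : 1 < p) (hp2 : p ≠ ⊤) (hκ : 0 < κ) (hc : 0 ≤ c)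
    {k : ℝ → ℝ → ℝ} (hk : Measurable fun z : ℝ × ℝ => k z.1 z.2)
    (hkb : ∀ x t, |k x t| ≤ c * Real.exp (-(κ * |x - t|))) :
    ∃ T : LpR p →L[ℝ] LpR p,
      ∀ f : LpR p, (T f : ℝ → ℝ) =ᵐ[volume] fun x => ∫ t, k x t * (f : ℝ → ℝ) t := by
  have hmem : ∀ f : LpR p, MemLp (fun x => ∫ t, k x t * (f : ℝ → ℝ) t) p := fun f => by
    refine ⟨?_, ?_⟩
    · have h1 : StronglyMeasurable fun z : ℝ × ℝ => k z.1 z.2 * (f : ℝ → ℝ) z.2 :=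
        hk.stronglyMeasurable.mul ((Lp.stronglyMeasurable f).comp_measurable measurable_snd)
      exact (h1.integral_prod_right').aestronglyMeasurable
    · exact (eLpNorm_integral_le hp1 hp2 hκ hc hkb (Lp.aestronglyMeasurable f)
        EventuallyEq.rfl).trans_lt (ENNReal.mul_lt_top ENNReal.ofReal_lt_top (Lp.eLpNorm_lt_top f))
  have hint : ∀ x (f : LpR p), Integrable fun t => k x t * (f : ℝ → ℝ) t := fun x f =>
    integrable_mul_of_abs_le_exp hp1 hκ (hk.comp measurable_prodMk_left) (hkb x) f
  let T : LpR p →ₗ[ℝ] LpR p :=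
    { toFun := fun f => (hmem f).toLp _
      map_add' := fun f g => by
        rw [← MemLp.toLp_add]
        refine MemLp.toLp_congr _ _ (ae_of_all _ fun x => ?_)
        simp only [Pi.add_apply]
        rw [← integral_add (hint x f) (hint x g)]
        refine integral_congr_ae ?_
        filter_upwards [Lp.coeFn_add f g] with t ht
        rw [ht, Pi.add_apply, mul_add]
      map_smul' := fun a f => by
        rw [← MemLp.toLp_const_smul]
        refine MemLp.toLp_congr _ _ (ae_of_all _ fun x => ?_)
        simp only [Pi.smul_apply, RingHom.id_apply, smul_eq_mul]
        rw [← integral_const_mul]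
        refine integral_congr_ae ?_
        filter_upwards [Lp.coeFn_smul a f] with t ht
        rw [ht, Pi.smul_apply, smul_eq_mul]
        ring }
  exact ⟨T.mkContinuous _ fun f => norm_le_of_ae_eq_integral hp1 hp2 hκ hc hkb
    (hmem f).coeFn_toLp, fun f => (hmem f).coeFn_toLp⟩

/-- Finite-rank operators producing step functions on the cells `⌊n * x⌋ = i`. -/
theorem exists_compact_step {n : ℝ} (hn : 0 < n) (φ : ℤ → LpR p →L[ℝ] ℝ) (s : Finset ℤ) :
    ∃ F : LpR p →L[ℝ] LpR p, IsCompactOperator F ∧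
      ∀ f : LpR p, (F f : ℝ → ℝ) =ᵐ[volume] fun x => if ⌊n * x⌋ ∈ s then φ ⌊n * x⌋ f else 0 := by
  induction s using Finset.induction_on with
  | empty =>
    refine ⟨0, isCompactOperator_zero, fun f => ae_of_all _ fun x => ?_⟩
    simp
  | insert i s hi ih =>
    obtain ⟨F, hF, hFf⟩ := ih
    have hmeas : MeasurableSet {x : ℝ | ⌊n * x⌋ = i} :=
      (Int.measurable_floor.comp (measurable_const_mul n)) (measurableSet_singleton i)
    have hsub : {x : ℝ | ⌊n * x⌋ = i} ⊆ Set.Icc (i / n) ((i + 1) / n) := fun x hx => by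
      obtain ⟨h1, h2⟩ := Int.floor_eq_iff.1 hx
      constructor
      · rw [div_le_iff₀ hn]; linarith
      · rw [le_div_iff₀ hn]; linarith
    have hfin : volume {x : ℝ | ⌊n * x⌋ = i} ≠ ⊤ :=
      ((measure_mono hsub).trans_lt measure_Icc_lt_top).ne
    let e : LpR p := indicatorConstLp p hmeas hfin (1 : ℝ)
    refine ⟨F + (φ i).smulRight e, hF.add ?_, fun f => ?_⟩
    · exact (isCompactOperator_of_locallyCompactSpace_rng
        (ContinuousLinearMap.toSpanSingleton ℝ e)).comp_clm (φ i)
    · filter_upwards [hFf f, Lp.coeFn_add (F f) (φ i f • e), Lp.coeFn_smul (φ i f) e,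
        indicatorConstLp_coeFn (p := p) (hs := hmeas) (hμs := hfin) (c := (1 : ℝ))] with x h1 h2 h3 h4
      have h5 : (F + (φ i).smulRight e) f = F f + φ i f • e := rfl
      rw [h5, h2, Pi.add_apply, h3, Pi.smul_apply, h1, h4]
      by_cases hx : ⌊n * x⌋ = i
      · simp [hx, hi, Set.indicator]
      · simp [hx, Set.indicator]

end ExponentialKernel

namespace PFSS

variable {q u v u' v' : ℝ → ℝ}

theorem kernel_le_mul (h12 : Cond12 (fun _ => 1) q) (h : PFSS (fun _ => 1) q u v u' v')
    {η x y : ℝ} (hη : 0 ≤ η) (hu : u x ≤ (1 + η) * u y) (hv : v x ≤ (1 + η) * v y) (t : ℝ) :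
    greenKernel u v x t ≤ (1 + η) * greenKernel u v y t := by
  rw [h.eq_min h12, h.eq_min h12, mul_min_of_nonneg _ _ (by linarith)]
  refine min_le_min ?_ ?_
  · nlinarith [mul_le_mul_of_nonneg_right hu (h.v_pos t).le]
  · nlinarith [mul_le_mul_of_nonneg_left hv (h.u_pos t).le]

theorem abs_kernel_sub_le (h12 : Cond12 (fun _ => 1) q) (h : PFSS (fun _ => 1) q u v u' v')
    {η x y : ℝ} (hη : 0 ≤ η) (hη1 : η ≤ 1) (hu : u x ≤ (1 + η) * u y)
    (hv : v x ≤ (1 + η) * v y) (hu' : u y ≤ (1 + η) * u x) (hv' : v y ≤ (1 + η) * v x) (t : ℝ) :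
    |greenKernel u v x t - greenKernel u v y t| ≤ 2 * η * greenKernel u v x t := by
  have h1 := h.kernel_le_mul h12 hη hu hv t
  have h2 := h.kernel_le_mul h12 hη hu' hv' t
  have h3 := h.kernel_pos h12 x t
  rw [abs_le]
  constructor
  · nlinarith
  · have h4 := mul_le_mul_of_nonneg_left h2 hη
    nlinarith [mul_nonneg hη (mul_nonneg (sub_nonneg.2 hη1) h3.le)]

/-- Molchanov's condition forces the diagonal of the Green kernel to vanish at infinity. -/
theorem tendsto_diag (h12 : Cond12 (fun _ => 1) q) (h : PFSS (fun _ => 1) q u v u' v')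
    (hM : ∀ a : ℝ, 0 < a → Tendsto (fun x => ∫ t in x - a..x + a, q t) (cocompact ℝ) atTop)
    {ε : ℝ} (hε : 0 < ε) : ∀ᶠ x in cocompact ℝ, u x * v x ≤ ε := by
  have h1 := (hM (ε / 4) (by linarith)).eventually_ge_atTop (2 / ε)
  have h2 : Tendsto (fun x : ℝ => x - ε / 4) (cocompact ℝ) (cocompact ℝ) :=
    (Homeomorph.subRight (ε / 4)).isClosedEmbedding.tendsto_cocompact
  filter_upwards [h2.eventually h1] with x hx
  have h3 := h.diag_le h12 (by linarith) (by positivity) hx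
  rw [sub_add_cancel, one_div_div] at h3
  linarith

theorem exists_near (h12 : Cond12 (fun _ => 1) q) (h : PFSS (fun _ => 1) q u v u' v')
    (R : ℝ) {η : ℝ} (hη : 0 < η) : ∃ δ > 0, ∀ x ∈ Set.Icc (-R) R, ∀ y ∈ Set.Icc (-R) R,
      |x - y| < δ → u x ≤ (1 + η) * u y ∧ v x ≤ (1 + η) * v y := by
  have key : ∀ w : ℝ → ℝ, (∀ x, 0 < w x) → Continuous w → ∃ δ > 0, ∀ x ∈ Set.Icc (-R) R,
      ∀ y ∈ Set.Icc (-R) R, |x - y| < δ → w x ≤ (1 + η) * w y := by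
    intro w hw hc
    have hlog : Continuous fun x => Real.log (w x) := hc.log fun x => (hw x).ne'
    obtain ⟨δ, hδ, hδ'⟩ := Metric.uniformContinuousOn_iff.1
      ((isCompact_Icc (a := -R) (b := R)).uniformContinuousOn_of_continuous hlog.continuousOn)
      (Real.log (1 + η)) (Real.log_pos (by linarith))
    refine ⟨δ, hδ, fun x hx y hy hxy => ?_⟩
    have h1 := hδ' x hx y hy hxy
    rw [Real.dist_eq] at h1
    have h2 := (abs_lt.1 h1).2
    rw [← Real.log_le_log_iff (hw x) (mul_pos (by linarith) (hw y)),
      Real.log_mul (by linarith) (hw y).ne']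
    linarith
  obtain ⟨δ₁, h1, h1'⟩ := key u h.u_pos (h.continuous_u h12)
  obtain ⟨δ₂, h2, h2'⟩ := key v h.v_pos (h.continuous_v h12)
  exact ⟨min δ₁ δ₂, lt_min h1 h2, fun x hx y hy hxy =>
    ⟨h1' x hx y hy (hxy.trans_le (min_le_left _ _)), h2' x hx y hy (hxy.trans_le (min_le_right _ _))⟩⟩

variable {p : ℝ≥0∞} [Fact (1 ≤ p)] {κ K : ℝ}

theorem isCompactOperator_of_diag (h12 : Cond12 (fun _ => 1) q)
    (h : PFSS (fun _ => 1) q u v u' v') (hp1 : 1 < p) (hp2 : p ≠ ⊤) (hκ : 0 < κ) (hK : 0 < K)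
    (hρ : ∀ x t, greenKernel u v x t ≤ u x * v x * Real.exp (-(κ * |x - t|)))
    (hρK : ∀ x, u x * v x ≤ K) (hlim : ∀ ε : ℝ, 0 < ε → ∀ᶠ x in cocompact ℝ, u x * v x ≤ ε)
    {G : LpR p →L[ℝ] LpR p} (hG : IsGreenOp u v p G) : IsCompactOperator G := by
  have hmeas := measurable_greenKernel (h.continuous_u h12) (h.continuous_v h12)
  have hbd : ∀ x t, |greenKernel u v x t| ≤ K * Real.exp (-(κ * |x - t|)) := fun x t => by
    rw [abs_of_pos (h.kernel_pos h12 x t)]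
    exact (hρ x t).trans (mul_le_mul_of_nonneg_right (hρK x) (Real.exp_pos _).le)
  have hmeas' : ∀ x, Measurable fun t => greenKernel u v x t := fun x =>
    hmeas.comp measurable_prodMk_left
  suffices hcl : G ∈ closure { F : LpR p →L[ℝ] LpR p | IsCompactOperator F } by
    rwa [isClosed_setOfPred_isCompactOperator.closure_eq] at hcl
  rw [Metric.mem_closure_iff]
  intro ε hε
  set A := ∫ y : ℝ, Real.exp (-(κ * |y|)) with hA
  have hA0 : 0 ≤ A := integral_exp_neg_mul_abs_nonneg κ
  set c := ε / (A + 1) with hc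
  have hc0 : 0 < c := by positivity
  have hcA : c * A < ε := by
    rw [hc, div_mul_eq_mul_div, div_lt_iff₀ (by positivity)]
    nlinarith
  obtain ⟨R, hR⟩ : ∃ R : ℝ, ∀ x, R < |x| → u x * v x ≤ c := by
    have h1 := hlim c hc0
    rw [← Metric.cobounded_eq_cocompact,
      (Metric.hasBasis_cobounded_compl_closedBall (0 : ℝ)).eventually_iff] at h1
    obtain ⟨R, -, hR⟩ := h1
    exact ⟨R, fun x hx => hR (by simpa using hx)⟩
  obtain ⟨N, hN⟩ := exists_nat_gt R
  set η := min 1 (c / (2 * K)) with hη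
  have hη0 : 0 < η := lt_min one_pos (by positivity)
  have hη1 : η ≤ 1 := min_le_left _ _
  have hηK : 2 * η * K ≤ c := by
    have : η ≤ c / (2 * K) := min_le_right _ _
    rw [le_div_iff₀ (by positivity)] at this
    linarith
  obtain ⟨δ, hδ, hnear⟩ := h.exists_near h12 N hη0
  obtain ⟨n, hn0, hnδ⟩ : ∃ n : ℕ, 0 < (n : ℝ) ∧ 1 / (n : ℝ) < δ := by
    obtain ⟨n, hn⟩ := exists_nat_one_div_lt hδ
    exact ⟨n + 1, by positivity, by simpa using hn⟩
  choose φ hφ using fun i : ℤ => exists_functional (p := p) hp1 hκ (hmeas' ((i : ℝ) / n))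
    (hbd ((i : ℝ) / n))
  let s : Finset ℤ := Finset.Ico (-((N : ℤ) * n)) ((N : ℤ) * n)
  obtain ⟨F, hF, hFf⟩ := exists_compact_step hn0 φ s
  refine ⟨F, hF, ?_⟩
  rw [dist_eq_norm]
  let k : ℝ → ℝ → ℝ := fun x t => greenKernel u v x t -
    if ⌊(n : ℝ) * x⌋ ∈ s then greenKernel u v ((⌊(n : ℝ) * x⌋ : ℝ) / n) t else 0
  have hk : ∀ x t, |k x t| ≤ c * Real.exp (-(κ * |x - t|)) := by
    intro x t
    have hle := Int.floor_le ((n : ℝ) * x)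
    have hlt := Int.lt_floor_add_one ((n : ℝ) * x)
    by_cases hx : ⌊(n : ℝ) * x⌋ ∈ s
    · simp only [k, hx, if_true]
      obtain ⟨hs1, hs2⟩ := Finset.mem_Ico.1 hx
      set y : ℝ := (⌊(n : ℝ) * x⌋ : ℝ) / n with hy
      have hs1' : -((N : ℝ) * n) ≤ ⌊(n : ℝ) * x⌋ := by exact_mod_cast hs1
      have hs2' : (⌊(n : ℝ) * x⌋ : ℝ) + 1 ≤ (N : ℝ) * n := by exact_mod_cast hs2
      have hy1 : -(N : ℝ) ≤ y := by rw [hy, le_div_iff₀ hn0]; linarith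
      have hyx : y ≤ x := by rw [hy, div_le_iff₀ hn0]; linarith
      have hxN : x ≤ N := le_of_mul_le_mul_left (by linarith : (n : ℝ) * x ≤ n * N) hn0
      have hxy : x - y < δ := by
        have : x < y + 1 / n := by
          rw [hy, ← add_div, lt_div_iff₀ hn0]; linarith
        linarith
      have hxm : x ∈ Set.Icc (-(N : ℝ)) N := ⟨hy1.trans hyx, hxN⟩
      have hym : y ∈ Set.Icc (-(N : ℝ)) N := ⟨hy1, hyx.trans hxN⟩
      have hd : |x - y| < δ := by rwa [abs_of_nonneg (by linarith)]
      obtain ⟨a1, a2⟩ := hnear x hxm y hym hd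
      obtain ⟨a3, a4⟩ := hnear y hym x hxm (by rwa [abs_sub_comm])
      refine (h.abs_kernel_sub_le h12 hη0.le hη1 a1 a2 a3 a4 t).trans ?_
      have h5 := (le_abs_self _).trans (hbd x t)
      calc _ ≤ 2 * η * (K * Real.exp (-(κ * |x - t|))) :=
            mul_le_mul_of_nonneg_left h5 (by positivity)
        _ = 2 * η * K * Real.exp (-(κ * |x - t|)) := by ring
        _ ≤ _ := mul_le_mul_of_nonneg_right hηK (Real.exp_pos _).le
    · simp only [k, hx, if_false, sub_zero]
      rw [abs_of_pos (h.kernel_pos h12 x t)]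
      refine (hρ x t).trans (mul_le_mul_of_nonneg_right (hR x (hN.trans_le ?_)) (Real.exp_pos _).le)
      rw [Finset.mem_Ico, not_and_or, not_le, not_lt] at hx
      rcases hx with hx | hx
      · have hx' : (⌊(n : ℝ) * x⌋ : ℝ) + 1 ≤ -((N : ℝ) * n) := by exact_mod_cast hx
        have : x ≤ -N := le_of_mul_le_mul_left (by linarith : (n : ℝ) * x ≤ n * -N) hn0
        rw [le_abs]; right; linarith
      · have hx' : (N : ℝ) * n ≤ ⌊(n : ℝ) * x⌋ := by exact_mod_cast hx
        have : (N : ℝ) ≤ x := le_of_mul_le_mul_left (by linarith : (n : ℝ) * N ≤ n * x) hn0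
        exact this.trans (le_abs_self x)
  refine ((G - F).opNorm_le_bound (by positivity) fun f => ?_).trans_lt hcA
  refine norm_le_of_ae_eq_integral hp1 hp2 hκ hc0.le hk ?_
  filter_upwards [hG f, hFf f, Lp.coeFn_sub (G f) (F f)] with x h1 h2 h3
  have h4 : (G - F) f = G f - F f := rfl
  rw [h4, h3, Pi.sub_apply, h1, h2]
  by_cases hx : ⌊(n : ℝ) * x⌋ ∈ s
  · simp only [k, hx, if_true, sub_mul]
    rw [hφ, integral_sub (integrable_mul_of_abs_le_exp hp1 hκ (hmeas' x) (hbd x) f)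
      (integrable_mul_of_abs_le_exp hp1 hκ (hmeas' _) (hbd _) f)]
  · simp only [k, hx, if_false, sub_zero]

/-- Compactness of the Green operator forces Molchanov's condition. -/
theorem molchanov_of_isCompactOperator (h12 : Cond12 (fun _ => 1) q)
    (h : PFSS (fun _ => 1) q u v u' v') (hp1 : 1 < p) (hp2 : p ≠ ⊤) (hκ : 0 < κ) (hK : 0 < K)
    (hbd : ∀ x t, greenKernel u v x t ≤ K * Real.exp (-(κ * |x - t|)))
    {G : LpR p →L[ℝ] LpR p} (hG : IsGreenOp u v p G) (hcomp : IsCompactOperator G)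
    {a : ℝ} (ha : 0 < a) :
    Tendsto (fun x => ∫ t in x - a..x + a, q t) (cocompact ℝ) atTop := by
  by_contra hnot
  rw [tendsto_atTop] at hnot
  push Not at hnot
  obtain ⟨C', hC'⟩ := hnot
  have hC : ∃ᶠ x in cocompact ℝ, ∫ t in x - a..x + a, q t ≤ max C' 0 :=
    hC'.mono fun x hx => hx.le.trans (le_max_left _ _)
  set C := max C' 0
  have hC0 : 0 ≤ C := le_max_right _ _
  set M := 2 / a + C with hM
  have hM0 : 0 < M := by positivity
  set b := 1 / (4 * M) with hb
  have hb0 : 0 < b := by positivity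
  have hp0 : p ≠ 0 := (zero_lt_one.trans hp1).ne'
  have hmeas := measurable_greenKernel (h.continuous_u h12) (h.continuous_v h12)
  have hmeas' : ∀ x, Measurable fun t => greenKernel u v x t := fun x =>
    hmeas.comp measurable_prodMk_left
  let I : ℝ → Set ℝ := fun x => Set.Icc (x - b) (x + b)
  have hIm : ∀ x, MeasurableSet (I x) := fun x => measurableSet_Icc
  have hIf : ∀ x, volume (I x) ≠ ⊤ := fun x => measure_Icc_lt_top.ne
  have hIr : ∀ x, volume.real (I x) = 2 * b := fun x => by
    simp only [I]
    rw [Real.volume_real_Icc_of_le (by linarith)]; ring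
  let e : ℝ → LpR p := fun x => indicatorConstLp p (hIm x) (hIf x) (1 : ℝ)
  set m := (2 * b) ^ (1 / p.toReal) with hm
  have hm0 : 0 < m := by positivity
  have he : ∀ x, e x ∈ Metric.closedBall (0 : LpR p) m := fun x => by
    rw [mem_closedBall_zero_iff, norm_indicatorConstLp hp0 hp2, hIr]
    simp [hm]
  have hGe : ∀ x, (G (e x) : ℝ → ℝ) =ᵐ[volume] fun s => ∫ t in I x, greenKernel u v s t := by
    intro x
    filter_upwards [hG (e x)] with s hs
    rw [hs, ← integral_indicator (hIm x)]
    refine integral_congr_ae ?_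
    filter_upwards [indicatorConstLp_coeFn (p := p) (hs := hIm x) (hμs := hIf x) (c := (1 : ℝ))]
      with t ht
    rw [ht]
    by_cases htx : t ∈ I x <;> simp [htx]
  have hint : ∀ s x, IntegrableOn (fun t => greenKernel u v s t) (I x) := fun s x => by
    refine Measure.integrableOn_of_bounded (M := K) (hIf x) (hmeas' s).aestronglyMeasurable
      (ae_of_all _ fun t => ?_)
    rw [Real.norm_of_nonneg (h.kernel_pos h12 s t).le]
    refine (hbd s t).trans (mul_le_of_le_one_right hK.le (Real.exp_le_one_iff.2 ?_))
    have := mul_nonneg hκ.le (abs_nonneg (s - t))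
    linarith
  have hlow : ∀ x, ∫ t in x - a..x + a, q t ≤ C → ∀ s ∈ I x,
      2 * b * b ≤ ∫ t in I x, greenKernel u v s t := by
    intro x hx s hs
    have h1 := setIntegral_mono_on (f := fun _ => b) (integrableOn_const (hIf x)) (hint s x) (hIm x)
      fun t ht => h.le_kernel h12 ha hx hM hs ht
    rwa [setIntegral_const, hIr, smul_eq_mul] at h1
  obtain ⟨R, hR⟩ : ∃ R : ℝ, ∀ r, R < r → K * Real.exp (-(κ * (r - 2 * b))) ≤ b / 2 := by
    have h1 : Tendsto (fun r : ℝ => K * Real.exp (-(κ * (r - 2 * b)))) atTop (𝓝 (K * 0)) := by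
      refine Tendsto.const_mul K (Real.tendsto_exp_atBot.comp (tendsto_neg_atTop_atBot.comp ?_))
      exact Tendsto.const_mul_atTop hκ (tendsto_atTop_add_const_right _ _ tendsto_id)
    rw [mul_zero] at h1
    obtain ⟨R, hR⟩ := eventually_atTop.1 (h1.eventually_le_const (by positivity : 0 < b / 2))
    exact ⟨R, fun r hr => hR r hr.le⟩
  have hup : ∀ x y, R < |x - y| → ∀ s ∈ I x, ∫ t in I y, greenKernel u v s t ≤ b * b := by
    intro x y hxy s hs
    have h1 := setIntegral_mono_on (g := fun _ => b / 2) (hint s y) (integrableOn_const (hIf y))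
      (hIm y) fun t ht => by
        refine (hbd s t).trans (le_trans ?_ (hR _ hxy))
        have h2 : |x - y| - 2 * b ≤ |s - t| := by
          have e1 : |x - s| ≤ b := abs_le.2 ⟨by linarith [hs.2], by linarith [hs.1]⟩
          have e2 : |t - y| ≤ b := abs_le.2 ⟨by linarith [ht.1], by linarith [ht.2]⟩
          have e3 : |x - y| ≤ |x - s| + |s - t| + |t - y| :=
            (abs_sub_le x t y).trans (add_le_add_left (abs_sub_le x s t) _)
          linarith
        gcongr
    rw [setIntegral_const, hIr, smul_eq_mul] at h1
    linarith
  have hsep : ∀ x y, ∫ t in x - a..x + a, q t ≤ C → R < |x - y| →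
      b * b * m ≤ ‖G (e x) - G (e y)‖ := by
    intro x y hx hxy
    have h1 : ‖indicatorConstLp p (hIm x) (hIf x) (b * b)‖ = b * b * m := by
      rw [norm_indicatorConstLp hp0 hp2, hIr, Real.norm_of_nonneg (by positivity)]
    rw [← h1]
    refine Lp.norm_le_norm_of_ae_le ?_
    filter_upwards [hGe x, hGe y, Lp.coeFn_sub (G (e x)) (G (e y)),
      indicatorConstLp_coeFn (p := p) (hs := hIm x) (hμs := hIf x) (c := b * b)] with s h2 h3 h4 h5
    rw [h5, h4, Pi.sub_apply, h2, h3]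
    by_cases hs : s ∈ I x
    · rw [Set.indicator_of_mem hs, Real.norm_of_nonneg (by positivity)]
      refine le_trans ?_ (le_abs_self _)
      linarith [hlow x hx s hs, hup x y hxy s hs]
    · rw [Set.indicator_of_notMem hs, norm_zero]
      exact norm_nonneg _
  obtain ⟨S, hS, hSG⟩ := hcomp.image_closedBall_subset_compact (f := (G : LpR p →ₗ[ℝ] LpR p)) m
  set l : Filter ℝ := cocompact ℝ ⊓ 𝓟 {x | ∫ t in x - a..x + a, q t ≤ C} with hl
  have hlne : l.NeBot := frequently_mem_iff_neBot.1 hC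
  obtain ⟨g, -, hg⟩ := hS.exists_mapClusterPt_of_frequently (l := l) (f := fun x => G (e x))
    (Frequently.of_forall fun x => hSG ⟨e x, he x, rfl⟩)
  have hfreq : ∃ᶠ x in l, G (e x) ∈ Metric.ball g (b * b * m / 2) :=
    hg.frequently (Metric.ball_mem_nhds g (by positivity))
  obtain ⟨x, hx1, hx2⟩ := (hfreq.and_eventually
    (mem_inf_of_right (mem_principal_self {x | ∫ t in x - a..x + a, q t ≤ C}))).exists
  have hfar : ∀ᶠ y in l, R < |x - y| := by
    refine Eventually.filter_mono inf_le_left ?_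
    rw [← Metric.cobounded_eq_cocompact]
    filter_upwards [(Metric.hasBasis_cobounded_compl_closedBall x).mem_of_mem
      (i := R) trivial] with y hy
    simpa [Real.dist_eq, abs_sub_comm] using hy
  obtain ⟨y, hy1, hy2⟩ := (hfreq.and_eventually hfar).exists
  have h1 := hsep x y hx2 hy2
  rw [← dist_eq_norm] at h1
  have h2 := dist_triangle_right (G (e x)) (G (e y)) g
  rw [Metric.mem_ball] at hx1 hy1
  linarith

end PFSS

/-- **Corollary 3.9.** Assume (1.2) with `r ≡ 1`, let `u, v` be a principal
FSS of `z'' = q z`, and suppose `inf_x ∫_{x-a₀}^{x+a₀} q > 0` for some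
`a₀ > 0`.  Then for every `p ∈ (1,∞)` the Green operator is bounded on
`L_p(ℝ)`, and it is compact iff Molchanov's condition holds. -/
theorem green_compact_iff_molchanov
    (q u v u' v' : ℝ → ℝ) (p : ℝ≥0∞) (hp1 : 1 < p) (hp2 : p ≠ ⊤)
    [Fact (1 ≤ p)]
    (h12 : Cond12 (fun _ => 1) q) (hfss : PFSS (fun _ => 1) q u v u' v')
    (a₀ : ℝ) (ha₀ : 0 < a₀)
    (hm : ∃ ε : ℝ, 0 < ε ∧ ∀ x : ℝ, ε ≤ ∫ t in x - a₀..x + a₀, q t) :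
    (∃ G : LpR p →L[ℝ] LpR p, IsGreenOp u v p G) ∧
      ∀ G : LpR p →L[ℝ] LpR p, IsGreenOp u v p G →
        (IsCompactOperator G ↔
          ∀ a : ℝ, 0 < a →
            Tendsto (fun x => ∫ t in x - a..x + a, q t) (cocompact ℝ) atTop) := by
  obtain ⟨m, hm0, hm⟩ := hm
  have hK : 0 < 1 / m + 2 * a₀ := by positivity
  set K := 1 / m + 2 * a₀
  have hκ : 0 < K⁻¹ := inv_pos.2 hK
  have hρ := hfss.kernel_le h12 (hfss.le_deriv_v h12 ha₀ hm0 hm) (hfss.le_deriv_u h12 ha₀ hm0 hm)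
  have hρK : ∀ x, u x * v x ≤ K := fun x => by
    have := hfss.diag_le h12 ha₀ hm0 (hm (x - a₀))
    rwa [sub_add_cancel] at this
  have hbd : ∀ x t, greenKernel u v x t ≤ K * Real.exp (-(K⁻¹ * |x - t|)) := fun x t =>
    (hρ x t).trans (mul_le_mul_of_nonneg_right (hρK x) (Real.exp_pos _).le)
  refine ⟨?_, fun G hG => ⟨fun hcomp a ha => ?_, fun hM => ?_⟩⟩
  · exact exists_integralOperator hp1 hp2 hκ hK.le
      (measurable_greenKernel (hfss.continuous_u h12) (hfss.continuous_v h12)) fun x t => by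
        rw [abs_of_pos (hfss.kernel_pos h12 x t)]
        exact hbd x t
  · exact hfss.molchanov_of_isCompactOperator h12 hp1 hp2 hκ hK hbd hG hcomp ha
  · exact hfss.isCompactOperator_of_diag h12 hp1 hp2 hκ hK hρ hρK
      (fun ε hε => hfss.tendsto_diag h12 hM hε) hG
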